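/- arXiv:1609.04498 — 4 statements merged into one kernel-verified Lean document; each statement's English description precedes it below -/
import Mathlib

section
/- Let (A,Ω) be a relative fractal drum in ℝ^N, let δ > 0, and let D̄ := dim̄_B(A,Ω), assumed to be a real number. Then for every s ∈ ℂ with Re s > D̄ both defining integrals converge absolutely and the functional equation ζ_{A,Ω}(s;δ) = δ^{s−N}·|A_δ ∩ Ω| + (N − s)·ζ̃_{A,Ω}(s;δ) holds. -/
open MeasureTheory Filter Complex Set Metric Topology Asymptotics
open scoped ENNReal NNReal

noncomputable section

/-- The open `t`-neighborhood `A_t = {x : dist(x,A) < t}` of a set `A ⊆ ℝ^N`. -/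
def nbhd (N : ℕ) (A : Set (EuclideanSpace ℝ (Fin N))) (t : ℝ) :
    Set (EuclideanSpace ℝ (Fin N)) :=
  {x | Metric.infDist x A < t}

/-- The volume `|A_t ∩ Ω|` of the `t`-neighborhood of `A` relative to `Ω`. -/
def tubeVol (N : ℕ) (A Ω : Set (EuclideanSpace ℝ (Fin N))) (t : ℝ) : ℝ :=
  (volume (nbhd N A t ∩ Ω)).toReal

/-- The upper `r`-dimensional Minkowski content of the relative fractal drum `(A,Ω)`. -/
def upperContent (N : ℕ) (A Ω : Set (EuclideanSpace ℝ (Fin N))) (r : ℝ) : ℝ≥0∞ :=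
  Filter.limsup
    (fun t : ℝ => volume (nbhd N A t ∩ Ω) / ENNReal.ofReal (t ^ ((N : ℝ) - r)))
    (nhdsWithin 0 (Set.Ioi 0))

/-- The lower `r`-dimensional Minkowski content of the relative fractal drum `(A,Ω)`. -/
def lowerContent (N : ℕ) (A Ω : Set (EuclideanSpace ℝ (Fin N))) (r : ℝ) : ℝ≥0∞ :=
  Filter.liminf
    (fun t : ℝ => volume (nbhd N A t ∩ Ω) / ENNReal.ofReal (t ^ ((N : ℝ) - r)))
    (nhdsWithin 0 (Set.Ioi 0))

/-- `D` is the (finite) upper box (Minkowski) dimension of `(A,Ω)`: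
the greatest lower bound of `{r : M^{*r}(A,Ω) = 0}`. -/
def IsUpperMinkDim (N : ℕ) (A Ω : Set (EuclideanSpace ℝ (Fin N))) (D : ℝ) : Prop :=
  IsGLB {r : ℝ | upperContent N A Ω r = 0} D

/-- `D` is the (finite) lower box (Minkowski) dimension of `(A,Ω)`. -/
def IsLowerMinkDim (N : ℕ) (A Ω : Set (EuclideanSpace ℝ (Fin N))) (D : ℝ) : Prop :=
  IsGLB {r : ℝ | lowerContent N A Ω r = 0} D

/-- The box (Minkowski) dimension of `(A,Ω)` exists and equals `D`. -/
def IsMinkDim (N : ℕ) (A Ω : Set (EuclideanSpace ℝ (Fin N))) (D : ℝ) : Prop :=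
  IsUpperMinkDim N A Ω D ∧ IsLowerMinkDim N A Ω D

/-- `(A,Ω)` is a relative fractal drum in `ℝ^N`. -/
def IsRFD (N : ℕ) (A Ω : Set (EuclideanSpace ℝ (Fin N))) : Prop :=
  A.Nonempty ∧ MeasurableSet Ω ∧ volume Ω < ⊤ ∧ ∃ δ₀ > (0 : ℝ), Ω ⊆ nbhd N A δ₀

/-- The relative distance zeta function `ζ_{A,Ω}(s) = ∫_Ω d(x,A)^{s-N} dx`. -/
def distZeta (N : ℕ) (A Ω : Set (EuclideanSpace ℝ (Fin N))) (s : ℂ) : ℂ :=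
  ∫ x in Ω, (Metric.infDist x A : ℂ) ^ (s - (N : ℂ))

/-- The relative distance zeta function with parameter `δ`:
`ζ_{A,Ω}(s;δ) = ∫_{A_δ ∩ Ω} d(x,A)^{s-N} dx`. -/
def distZetaD (N : ℕ) (A Ω : Set (EuclideanSpace ℝ (Fin N))) (δ : ℝ) (s : ℂ) : ℂ :=
  ∫ x in nbhd N A δ ∩ Ω, (Metric.infDist x A : ℂ) ^ (s - (N : ℂ))

/-- The relative tube zeta function `ζ̃_{A,Ω}(s;δ) = ∫_0^δ t^{s-N-1}|A_t ∩ Ω| dt`. -/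
def tubeZeta (N : ℕ) (A Ω : Set (EuclideanSpace ℝ (Fin N))) (δ : ℝ) (s : ℂ) : ℂ :=
  ∫ t in Set.Ioc (0 : ℝ) δ, (t : ℂ) ^ (s - (N : ℂ) - 1) * ((tubeVol N A Ω t : ℝ) : ℂ)

/-- The Mellin zeta function `ζ^𝔐_{A,Ω}(s) = ∫_0^∞ t^{s-N-1}|A_t ∩ Ω| dt`. -/
def mellinZeta (N : ℕ) (A Ω : Set (EuclideanSpace ℝ (Fin N))) (s : ℂ) : ℂ :=
  ∫ t in Set.Ioi (0 : ℝ), (t : ℂ) ^ (s - (N : ℂ) - 1) * ((tubeVol N A Ω t : ℝ) : ℂ)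

/-- `(A,Ω)` is Minkowski measurable with dimension `D` and Minkowski content `M`. -/
def MinkMeasurable (N : ℕ) (A Ω : Set (EuclideanSpace ℝ (Fin N))) (D M : ℝ) : Prop :=
  0 < M ∧
    Tendsto (fun t : ℝ => tubeVol N A Ω t / t ^ ((N : ℝ) - D))
      (nhdsWithin 0 (Set.Ioi 0)) (nhds M)

/-- `ω` is a pole of `F` (the norm of `F` blows up at `ω`). -/
def IsPoleAt (F : ℂ → ℂ) (ω : ℂ) : Prop :=
  Tendsto (fun s => ‖F s‖) (nhdsWithin ω {ω}ᶜ) atTop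

/-- The languidity conditions **L1**–**L2** for `F` with screen `S`, exponent `κ`,
constants `c`, `C` and two-sided sequence `T`. -/
def LanguidWith (F : ℂ → ℂ) (S : ℝ → ℝ) (κ c C : ℝ) (T : ℤ → ℝ) : Prop :=
  0 < C ∧
  (∀ n : ℤ, 1 ≤ n → T (-n) < 0 ∧ 0 < T n) ∧
  Tendsto (fun n : ℕ => T (n : ℤ)) atTop atTop ∧
  Tendsto (fun n : ℕ => T (-(n : ℤ))) atTop atBot ∧
  (∀ n : ℤ, ∀ σ : ℝ, S (T n) < σ → σ < c →
    ‖F ((σ : ℂ) + (T n : ℝ) * Complex.I)‖ ≤ C * (|T n| + 1) ^ κ) ∧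
  (∀ τ : ℝ, 1 ≤ |τ| → ‖F ((S τ : ℂ) + (τ : ℝ) * Complex.I)‖ ≤ C * |τ| ^ κ)

/-- `S` is a screen (for upper box dimension `D`): a Lipschitz function bounded below,
with `sup S ≤ D`. -/
def IsScreen (S : ℝ → ℝ) (D : ℝ) : Prop :=
  (∃ K : NNReal, LipschitzWith K S) ∧ BddBelow (Set.range S) ∧ ∀ τ : ℝ, S τ ≤ D

/-- The window associated with the screen `S`. -/
def window (S : ℝ → ℝ) : Set ℂ :=
  {s : ℂ | S s.im ≤ s.re}


/-- For `f` with values in `[0, δ)`, integrating `t ↦ t ^ (z - 1) * μ {f < t}` over `(0, δ]`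
amounts to integrating `f ^ z` (integration by parts in the layer cake form). -/
theorem integrable_cpow_and_integral_eq_of_tail {X : Type*} [MeasurableSpace X] {μ : Measure X}
    [IsFiniteMeasure μ] {f : X → ℝ} (hf : Measurable f) (hf0 : ∀ x, 0 ≤ f x) {δ : ℝ} (hδ : 0 < δ)
    (hfδ : ∀ᵐ x ∂μ, f x < δ) (z : ℂ)
    (hint : IntegrableOn (fun t : ℝ => (t : ℂ) ^ (z - 1) * (μ.real {x | f x < t} : ℂ))
      (Ioc 0 δ)) :
    Integrable (fun x => (f x : ℂ) ^ z) μ ∧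
      ∫ x, (f x : ℂ) ^ z ∂μ = (δ : ℂ) ^ z * (μ.real univ : ℂ)
        - z * ∫ t in Ioc 0 δ, (t : ℂ) ^ (z - 1) * (μ.real {x | f x < t} : ℂ) := by
  rcases eq_or_ne z 0 with rfl | hz
  · simp
  set ν : Measure ℝ := volume.restrict (Ioc 0 δ)
  let G : X × ℝ → ℂ := {p : X × ℝ | f p.1 < p.2}.indicator fun p => (p.2 : ℂ) ^ (z - 1)
  have hGmeas : Measurable G :=
    ((Complex.measurable_ofReal.comp measurable_snd).pow_const (z - 1)).indicator
      (measurableSet_lt (hf.comp measurable_fst) measurable_snd)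
  have hslice (t : ℝ) : MeasurableSet {x | f x < t} := measurableSet_lt hf measurable_const
  have hGt (t : ℝ) : (fun x => G (x, t)) = {x | f x < t}.indicator fun _ => (t : ℂ) ^ (z - 1) := by
    ext x
    simp [G, indicator]
  have hGx (x : X) : (fun t => G (x, t)) = (Ioi (f x)).indicator fun t => (t : ℂ) ^ (z - 1) := by
    ext t
    simp [G, indicator]
  have hGint : Integrable G (μ.prod ν) := by
    rw [integrable_prod_iff' hGmeas.aestronglyMeasurable]
    refine ⟨.of_forall fun t => ?_, ?_⟩
    · rw [hGt]
      exact (integrable_const _).indicator (hslice t)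
    · refine hint.norm.congr (.of_forall fun t => ?_)
      have h : (fun x => ‖G (x, t)‖) = {x | f x < t}.indicator fun _ => ‖(t : ℂ) ^ (z - 1)‖ := by
        ext x
        rw [congrFun (hGt t) x, norm_indicator_eq_indicator_norm]
      simp only [h, integral_indicator_const _ (hslice t), norm_mul, smul_eq_mul]
      simp [mul_comm]
  have hswap : ∫ x, ∫ t, G (x, t) ∂ν ∂μ
      = ∫ t, (t : ℂ) ^ (z - 1) * (μ.real {x | f x < t} : ℂ) ∂ν := by
    rw [integral_integral_swap (f := fun x t => G (x, t)) hGint]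
    refine integral_congr_ae (.of_forall fun t => ?_)
    simp only [hGt, integral_indicator_const _ (hslice t)]
    simp [mul_comm]
  have hcpow : ∀ᵐ x ∂μ, (δ : ℂ) ^ z - z * ∫ t, G (x, t) ∂ν = (f x : ℂ) ^ z := by
    filter_upwards [hfδ, hGint.prod_right_ae] with x hx hxi
    have hinter : Ioi (f x) ∩ Ioc 0 δ = Ioc (f x) δ := by
      ext t
      simp only [mem_inter_iff, mem_Ioi, mem_Ioc]
      exact ⟨fun h => ⟨h.1, h.2.2⟩, fun h => ⟨h.1, (hf0 x).trans_lt h.1, h.2⟩⟩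
    have hval : -1 < (z - 1).re ∨ z - 1 ≠ -1 ∧ (0 : ℝ) ∉ uIcc (f x) δ := by
      rcases (hf0 x).eq_or_lt with h0 | h0
      · left
        rw [hGx, integrable_indicator_iff measurableSet_Ioi, IntegrableOn,
          Measure.restrict_restrict measurableSet_Ioi, hinter, ← h0] at hxi
        exact (intervalIntegral.integrableOn_Ioo_cpow_iff hδ).1
          (IntegrableOn.mono_set hxi Ioo_subset_Ioc_self)
      · right
        refine ⟨fun h => hz (by linear_combination h), fun h => ?_⟩
        rw [uIcc_of_le hx.le] at h
        exact h0.not_ge h.1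
    rw [hGx, integral_indicator measurableSet_Ioi, Measure.restrict_restrict measurableSet_Ioi,
      hinter, ← intervalIntegral.integral_of_le hx.le, integral_cpow hval, sub_add_cancel]
    field_simp
    ring
  have hleft : Integrable (fun x => ∫ t, G (x, t) ∂ν) μ := hGint.integral_prod_left
  refine ⟨((integrable_const _).sub (hleft.const_mul z)).congr hcpow, ?_⟩
  rw [← integral_congr_ae hcpow, integral_sub (integrable_const _) (hleft.const_mul z),
    integral_const_mul, hswap, integral_const]
  simp [mul_comm]

theorem tubeVol_mono {N : ℕ} {A Ω : Set (EuclideanSpace ℝ (Fin N))} (hΩ : volume Ω ≠ ⊤) :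
    Monotone (tubeVol N A Ω) := fun _ _ h =>
  ENNReal.toReal_mono (measure_ne_top_of_subset inter_subset_right hΩ)
    (measure_mono (inter_subset_inter_left _ fun _ hx => lt_of_lt_of_le hx h))

/-- If the upper `r`-dimensional Minkowski content vanishes, the tube volume is eventually
at most `t ^ (N - r)`. -/
theorem eventually_tubeVol_le {N : ℕ} {A Ω : Set (EuclideanSpace ℝ (Fin N))} {r : ℝ}
    (hr : upperContent N A Ω r = 0) :
    ∀ᶠ t in 𝓝[>] (0 : ℝ), tubeVol N A Ω t ≤ t ^ ((N : ℝ) - r) := by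
  have hlt : upperContent N A Ω r < 1 := by rw [hr]; exact one_pos
  filter_upwards [eventually_lt_of_limsup_lt hlt, self_mem_nhdsWithin] with t ht ht0
  have hpos : 0 < t ^ ((N : ℝ) - r) := Real.rpow_pos_of_pos ht0 _
  refine ENNReal.toReal_le_of_le_ofReal hpos.le ?_
  have h := (ENNReal.div_le_iff (by simpa using hpos) ENNReal.ofReal_ne_top).1 ht.le
  rwa [one_mul] at h

/-- The tube zeta integral converges absolutely to the right of the upper box dimension. -/
theorem integrableOn_cpow_mul_tubeVol {N : ℕ} {A Ω : Set (EuclideanSpace ℝ (Fin N))}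
    (hΩ : volume Ω ≠ ⊤) {r : ℝ} (hr : upperContent N A Ω r = 0) {s : ℂ} (hrs : r < s.re) (δ : ℝ) :
    IntegrableOn (fun t : ℝ => (t : ℂ) ^ (s - (N : ℂ) - 1) * (tubeVol N A Ω t : ℂ))
      (Ioc 0 δ) := by
  obtain ⟨ε, hε, hle⟩ := (mem_nhdsGT_iff_exists_Ioc_subset).1 (eventually_tubeVol_le hr)
  have hε0 : (0 : ℝ) < ε := hε
  have hmeas : Measurable fun t : ℝ => (t : ℂ) ^ (s - (N : ℂ) - 1) * (tubeVol N A Ω t : ℂ) :=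
    (Complex.measurable_ofReal.pow_const _).mul
      (Complex.measurable_ofReal.comp (tubeVol_mono hΩ).measurable)
  have hnear : IntegrableOn (fun t : ℝ => (t : ℂ) ^ (s - (N : ℂ) - 1) * (tubeVol N A Ω t : ℂ))
      (Ioc 0 ε) := by
    have hdom : IntegrableOn (fun t : ℝ => t ^ (s.re - r - 1)) (Ioc 0 ε) :=
      (intervalIntegrable_iff_integrableOn_Ioc_of_le hε0.le).1
        (intervalIntegral.intervalIntegrable_rpow' (by linarith))
    refine hdom.mono' hmeas.aestronglyMeasurable ?_
    refine ae_restrict_of_forall_mem measurableSet_Ioc fun t ht => ?_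
    have hV0 : 0 ≤ tubeVol N A Ω t := ENNReal.toReal_nonneg
    rw [norm_mul, Complex.norm_cpow_eq_rpow_re_of_pos ht.1, Complex.norm_real,
      Real.norm_of_nonneg hV0]
    calc t ^ (s - (N : ℂ) - 1).re * tubeVol N A Ω t
        ≤ t ^ (s - (N : ℂ) - 1).re * t ^ ((N : ℝ) - r) :=
          mul_le_mul_of_nonneg_left (hle ht) (Real.rpow_nonneg ht.1.le _)
      _ = t ^ (s.re - r - 1) := by
          rw [← Real.rpow_add ht.1]
          congr 1
          simp
          ring
  have hfar : IntegrableOn (fun t : ℝ => (t : ℂ) ^ (s - (N : ℂ) - 1) * (tubeVol N A Ω t : ℂ))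
      (Icc ε δ) := by
    have hmono : MonotoneOn (tubeVol N A Ω) (Icc ε δ) := (tubeVol_mono hΩ).monotoneOn _
    refine IntegrableOn.continuousOn_mul ?_ ?_ isCompact_Icc
    · exact fun t ht => (Complex.continuousAt_ofReal_cpow_const _ _
        (Or.inr (hε0.trans_le ht.1).ne')).continuousWithinAt
    · exact (hmono.integrableOn_isCompact isCompact_Icc).ofReal
  refine (hnear.union hfar).mono_set fun t ht => ?_
  rcases le_total t ε with h | h
  exacts [Or.inl ⟨ht.1, h⟩, Or.inr ⟨h, ht.2⟩]

/-- Let `(A,Ω)` be a relative fractal drum in `ℝ^N`, let `δ > 0`, and let `D̄ := dim̄_B(A,Ω)`,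
assumed to be a real number.  Then for every `s ∈ ℂ` with `Re s > D̄` both defining
integrals converge absolutely and the functional equation
`ζ_{A,Ω}(s;δ) = δ^{s−N}·|A_δ ∩ Ω| + (N − s)·ζ̃_{A,Ω}(s;δ)` holds. -/
theorem statement2
    (N : ℕ) (A Ω : Set (EuclideanSpace ℝ (Fin N))) (δ Dbar : ℝ)
    (hRFD : IsRFD N A Ω) (hδ : 0 < δ) (hD : IsUpperMinkDim N A Ω Dbar) :
    ∀ s : ℂ, Dbar < s.re →
      IntegrableOn (fun x => (Metric.infDist x A : ℂ) ^ (s - (N : ℂ)))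
        (nbhd N A δ ∩ Ω) volume ∧
      IntegrableOn (fun t : ℝ => (t : ℂ) ^ (s - (N : ℂ) - 1) * ((tubeVol N A Ω t : ℝ) : ℂ))
        (Set.Ioc (0 : ℝ) δ) volume ∧
      distZetaD N A Ω δ s
        = (δ : ℂ) ^ (s - (N : ℂ)) * (((volume (nbhd N A δ ∩ Ω)).toReal : ℝ) : ℂ)
          + ((N : ℂ) - s) * tubeZeta N A Ω δ s := by
  intro s hs
  obtain ⟨-, hΩmeas, hΩ, -⟩ := hRFD
  obtain ⟨r, hr, -, hrs⟩ := hD.exists_between hs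
  have htube := integrableOn_cpow_mul_tubeVol hΩ.ne hr hrs δ
  have hdist : Measurable fun x : EuclideanSpace ℝ (Fin N) => infDist x A :=
    (continuous_infDist_pt A).measurable
  have hnbhd (t : ℝ) : MeasurableSet (nbhd N A t) := measurableSet_lt hdist measurable_const
  set μ : Measure (EuclideanSpace ℝ (Fin N)) := volume.restrict (nbhd N A δ ∩ Ω)
  have hμ : IsFiniteMeasure μ :=
    isFiniteMeasure_restrict.2 (measure_ne_top_of_subset inter_subset_right hΩ.ne)
  have hμδ : ∀ᵐ x ∂μ, infDist x A < δ :=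
    ae_restrict_of_forall_mem ((hnbhd δ).inter hΩmeas) fun x hx => hx.1
  have htail : EqOn
      (fun t : ℝ => (t : ℂ) ^ (s - (N : ℂ) - 1) * (tubeVol N A Ω t : ℂ))
      (fun t : ℝ => (t : ℂ) ^ (s - (N : ℂ) - 1) * (μ.real {x | infDist x A < t} : ℂ))
      (Ioc 0 δ) := by
    intro t ht
    have hsub : nbhd N A t ∩ (nbhd N A δ ∩ Ω) = nbhd N A t ∩ Ω := by
      have hle : nbhd N A t ⊆ nbhd N A δ := fun x hx => lt_of_lt_of_le hx ht.2
      rw [← inter_assoc, inter_eq_left.2 hle]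
    have hreal : μ.real {x | infDist x A < t} = tubeVol N A Ω t := by
      change (μ (nbhd N A t)).toReal = _
      rw [Measure.restrict_apply (hnbhd t), hsub, tubeVol]
    simp only [hreal]
  obtain ⟨hint, heq⟩ := integrable_cpow_and_integral_eq_of_tail hdist (fun _ => infDist_nonneg)
    hδ hμδ (s - N) (htube.congr_fun htail measurableSet_Ioc)
  refine ⟨hint, htube, ?_⟩
  rw [distZetaD, tubeZeta, setIntegral_congr_fun measurableSet_Ioc htail, heq, Measure.real,
    Measure.restrict_apply_univ]
  ring

end
end

section
/- Let (A,Ω) be a relative fractal drum in ℝ^N which is Minkowski nondegenerate, i.e., D := dim_B(A,Ω) exists and 0 < M_*^D(A,Ω) ≤ M^{*D}(A,Ω) < ∞, and assume D < N. Fix δ > 0, let U ⊆ ℂ be an open connected neighborhood of D, and let F be meromorphic on U with F(s) = ζ_{A,Ω}(s;δ) for all s ∈ U with Re s > D. Then D is a simple pole of F: the limit r := lim_{s→D}(s−D)F(s) exists, is real and nonzero; moreover (N−D)·M_*^D(A,Ω) ≤ r ≤ (N−D)·M^{*D}(A,Ω), and if in addition (A,Ω) is Minkowski measurable then r = (N−D)·M^D(A,Ω).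 -/
open MeasureTheory Filter Complex Set Metric Topology Asymptotics
open scoped ENNReal NNReal

noncomputable section

theorem lintegral_Ioi_ofReal_rpow {b c : ℝ} (hb : b < -1) (hc : 0 < c) :
    ∫⁻ u in Ioi c, ENNReal.ofReal (u ^ b) = ENNReal.ofReal (c ^ (b + 1) / -(b + 1)) := by
  rw [← ofReal_integral_eq_lintegral_ofReal (integrableOn_Ioi_rpow_of_lt hb hc),
    integral_Ioi_rpow_of_lt hb hc, neg_div, div_neg]
  filter_upwards [ae_restrict_mem measurableSet_Ioi] with u hu
  exact Real.rpow_nonneg (hc.le.trans (le_of_lt hu)) _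

theorem lintegral_Ioc_ofReal_rpow {b c : ℝ} (hb : -1 < b) (hc : 0 ≤ c) :
    ∫⁻ u in Ioc 0 c, ENNReal.ofReal (u ^ b) = ENNReal.ofReal (c ^ (b + 1) / (b + 1)) := by
  rw [← ofReal_integral_eq_lintegral_ofReal, ← intervalIntegral.integral_of_le hc,
    integral_rpow (Or.inl hb), Real.zero_rpow (by linarith), sub_zero]
  · exact (intervalIntegrable_iff_integrableOn_Ioc_of_le hc).1
      (intervalIntegral.intervalIntegrable_rpow' hb)
  · filter_upwards [ae_restrict_mem measurableSet_Ioc] with u hu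
    exact Real.rpow_nonneg hu.1.le _

section Moments

variable {X : Type*} [MeasurableSpace X] {μ : Measure X} {g : X → ℝ} {a K : ℝ}

theorem lintegral_Ioi_tail {p c : ℝ} (hp : 0 < p) (hpa : p < a) (hc : 0 < c) (hK : 0 ≤ K) :
    ENNReal.ofReal p * ∫⁻ u in Ioi c, ENNReal.ofReal (K * u ^ (-a)) * ENNReal.ofReal (u ^ (p - 1))
      = ENNReal.ofReal (p * K * c ^ (p - a) / (a - p)) := by
  have h : ∫⁻ u in Ioi c, ENNReal.ofReal (K * u ^ (-a)) * ENNReal.ofReal (u ^ (p - 1))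
      = ∫⁻ u in Ioi c, ENNReal.ofReal K * ENNReal.ofReal (u ^ (p - a - 1)) := by
    refine setLIntegral_congr_fun measurableSet_Ioi fun u hu => ?_
    have hu0 : 0 < u := hc.trans hu
    rw [← ENNReal.ofReal_mul (by positivity), ← ENNReal.ofReal_mul hK, mul_assoc,
      ← Real.rpow_add hu0]
    ring_nf
  rw [h, lintegral_const_mul' _ _ ENNReal.ofReal_ne_top,
    lintegral_Ioi_ofReal_rpow (by linarith) hc, ← ENNReal.ofReal_mul hK, ← ENNReal.ofReal_mul hp.le]
  ring_nf

theorem lintegral_rpow_le_of_tail_le [IsFiniteMeasure μ] (hg : Measurable g) (hg0 : ∀ x, 0 ≤ g x)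
    {p c : ℝ} (hp : 0 < p) (hpa : p < a) (hc : 0 < c) (hK : 0 ≤ K)
    (h : ∀ u, c < u → μ {x | u < g x} ≤ ENNReal.ofReal (K * u ^ (-a))) :
    ∫⁻ x, ENNReal.ofReal (g x ^ p) ∂μ
      ≤ ENNReal.ofReal (μ.real univ * c ^ p + p * K * c ^ (p - a) / (a - p)) := by
  have hap : 0 < a - p := sub_pos.2 hpa
  rw [lintegral_rpow_eq_lintegral_meas_lt_mul μ (.of_forall hg0) hg.aemeasurable hp,
    ← Ioc_union_Ioi_eq_Ioi hc.le, lintegral_union measurableSet_Ioi Ioc_disjoint_Ioi_same,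
    mul_add, ENNReal.ofReal_add (by positivity) (by positivity)]
  refine add_le_add ?_ ?_
  · calc _ ≤ ENNReal.ofReal p * ∫⁻ u in Ioc 0 c, μ univ * ENNReal.ofReal (u ^ (p - 1)) := by
          gcongr; exact subset_univ _
      _ = _ := by
          rw [lintegral_const_mul' _ _ (measure_ne_top _ _),
            lintegral_Ioc_ofReal_rpow (by linarith) hc.le, ← ofReal_measureReal,
            ← ENNReal.ofReal_mul (by positivity), ← ENNReal.ofReal_mul hp.le]
          congr 1
          rw [sub_add_cancel]
          field_simp
  · rw [← lintegral_Ioi_tail hp hpa hc hK]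
    refine mul_le_mul_right (setLIntegral_mono' measurableSet_Ioi fun u hu => ?_) _
    gcongr
    exact h u hu

theorem le_lintegral_rpow_of_le_tail (hg : Measurable g) (hg0 : ∀ x, 0 ≤ g x)
    {p c : ℝ} (hp : 0 < p) (hpa : p < a) (hc : 0 < c) (hK : 0 ≤ K)
    (h : ∀ u, c < u → ENNReal.ofReal (K * u ^ (-a)) ≤ μ {x | u < g x}) :
    ENNReal.ofReal (p * K * c ^ (p - a) / (a - p)) ≤ ∫⁻ x, ENNReal.ofReal (g x ^ p) ∂μ := by
  rw [lintegral_rpow_eq_lintegral_meas_lt_mul μ (.of_forall hg0) hg.aemeasurable hp,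
    ← lintegral_Ioi_tail hp hpa hc hK]
  refine mul_le_mul_right ((setLIntegral_mono' measurableSet_Ioi fun u hu => ?_).trans
    (lintegral_mono_set (Ioi_subset_Ioi hc.le))) _
  gcongr
  exact h u hu

theorem tendsto_tail_main {c : ℝ} (hc : 0 < c) :
    Tendsto (fun p => p * K * c ^ (p - a)) (𝓝[<] a) (𝓝 (a * K)) := by
  have : Continuous fun p => p * K * c ^ (p - a) := by
    have := hc.ne'
    fun_prop (disch := simp [*])
  simpa using (this.tendsto a).mono_left nhdsWithin_le_nhds

theorem eventually_moment_le [IsFiniteMeasure μ] (hg : Measurable g)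
    (hg0 : ∀ x, 0 ≤ g x) (ha : 0 < a) (hK : 0 ≤ K)
    (h : ∀ᶠ u in atTop, μ {x | u < g x} ≤ ENNReal.ofReal (K * u ^ (-a))) {ε : ℝ} (hε : 0 < ε) :
    ∀ᶠ p in 𝓝[<] a, ∫⁻ x, ENNReal.ofReal (g x ^ p) ∂μ < ⊤ ∧
      (a - p) * (∫⁻ x, ENNReal.ofReal (g x ^ p) ∂μ).toReal ≤ a * K + ε := by
  obtain ⟨c, hc⟩ := eventually_atTop.1 (h.and (eventually_gt_atTop 0))
  have hc0 := (hc c le_rfl).2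
  have hlim : Tendsto (fun p => (a - p) * (μ.real univ * c ^ p) + p * K * c ^ (p - a)) (𝓝[<] a)
      (𝓝 (0 + a * K)) := by
    refine Tendsto.add ?_ (tendsto_tail_main hc0)
    have : Continuous fun p => (a - p) * (μ.real univ * c ^ p) := by
      have := hc0.ne'
      fun_prop (disch := simp [*])
    simpa using (this.tendsto a).mono_left nhdsWithin_le_nhds
  filter_upwards [hlim.eventually_lt_const (u := a * K + ε) (by linarith), self_mem_nhdsWithin,
    Ioo_mem_nhdsLT ha] with p hp hpa hp0
  have hap : 0 < a - p := sub_pos.2 hpa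
  have hp0 := hp0.1
  have key := lintegral_rpow_le_of_tail_le hg hg0 hp0 hpa hc0 hK fun u hu => (hc u hu.le).1
  refine ⟨key.trans_lt ENNReal.ofReal_lt_top, le_trans ?_ hp.le⟩
  calc _ ≤ (a - p) * (μ.real univ * c ^ p + p * K * c ^ (p - a) / (a - p)) := by
        gcongr
        exact ENNReal.toReal_le_of_le_ofReal (by positivity) key
    _ = _ := by field_simp

theorem eventually_le_moment (hg : Measurable g)
    (hg0 : ∀ x, 0 ≤ g x) (ha : 0 < a) (hK : 0 ≤ K)
    (h : ∀ᶠ u in atTop, ENNReal.ofReal (K * u ^ (-a)) ≤ μ {x | u < g x})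
    (hfin : ∀ᶠ p in 𝓝[<] a, ∫⁻ x, ENNReal.ofReal (g x ^ p) ∂μ < ⊤) {ε : ℝ} (hε : 0 < ε) :
    ∀ᶠ p in 𝓝[<] a, a * K - ε ≤ (a - p) * (∫⁻ x, ENNReal.ofReal (g x ^ p) ∂μ).toReal := by
  obtain ⟨c, hc⟩ := eventually_atTop.1 (h.and (eventually_gt_atTop 0))
  have hc0 := (hc c le_rfl).2
  filter_upwards [(tendsto_tail_main (K := K) hc0).eventually_const_lt (u := a * K - ε) (by linarith),
    self_mem_nhdsWithin, Ioo_mem_nhdsLT ha, hfin] with p hp hpa hp0 hfin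
  have hap : 0 < a - p := sub_pos.2 hpa
  have key := le_lintegral_rpow_of_le_tail hg hg0 hp0.1 hpa hc0 hK fun u hu => (hc u hu.le).1
  rw [ENNReal.ofReal_le_iff_le_toReal hfin.ne, div_le_iff₀' hap] at key
  exact hp.le.trans key

end Moments

section Drum

variable {N : ℕ} {A Ω : Set (EuclideanSpace ℝ (Fin N))} {D δ K : ℝ}

theorem distZetaD_ofReal (s : ℝ) :
    distZetaD N A Ω δ s = ((∫⁻ x in nbhd N A δ ∩ Ω,
      ENNReal.ofReal ((infDist x A)⁻¹ ^ ((N : ℝ) - s))).toReal : ℝ) := by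
  have h (x : EuclideanSpace ℝ (Fin N)) :
      (infDist x A : ℂ) ^ ((s : ℂ) - N) = (((infDist x A)⁻¹ ^ ((N : ℝ) - s) : ℝ) : ℂ) := by
    rw [Real.inv_rpow infDist_nonneg, ← Real.rpow_neg infDist_nonneg, neg_sub,
      ofReal_cpow infDist_nonneg]
    push_cast
    rfl
  simp only [distZetaD, h]
  rw [integral_complex_ofReal, integral_eq_lintegral_of_nonneg_ae]
  · exact .of_forall fun x => Real.rpow_nonneg (inv_nonneg.2 infDist_nonneg) _
  · exact (((measurable_infDist (s := A)).inv).pow_const _).aestronglyMeasurable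

theorem measurableSet_nbhd (t : ℝ) : MeasurableSet (nbhd N A t) :=
  measurable_infDist measurableSet_Iio

theorem eventually_meas_lt_inv_infDist_le (hΩ : MeasurableSet Ω)
    (h : ∀ᶠ t in 𝓝[>] (0 : ℝ),
      volume (nbhd N A t ∩ Ω) ≤ ENNReal.ofReal (K * t ^ ((N : ℝ) - D))) :
    ∀ᶠ u in atTop, volume.restrict (nbhd N A δ ∩ Ω) {x | u < (infDist x A)⁻¹}
      ≤ ENNReal.ofReal (K * u ^ (-((N : ℝ) - D))) := by
  filter_upwards [tendsto_inv_atTop_nhdsGT_zero.eventually h, eventually_gt_atTop 0] with u hu hu0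
  rw [Real.inv_rpow hu0.le, ← Real.rpow_neg hu0.le] at hu
  refine le_trans ?_ hu
  rw [Measure.restrict_apply' ((measurableSet_nbhd δ).inter hΩ)]
  refine measure_mono fun x hx => ⟨?_, hx.2.2⟩
  have hx1 : u < (infDist x A)⁻¹ := hx.1
  exact (lt_inv_comm₀ hu0 (inv_pos.1 (hu0.trans hx1))).1 hx1

theorem eventually_le_meas_lt_inv_infDist (hΩ : MeasurableSet Ω) (hδ : 0 < δ)
    (hnull : volume ({x | infDist x A = 0} ∩ Ω) = 0)
    (h : ∀ᶠ t in 𝓝[>] (0 : ℝ),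
      ENNReal.ofReal (K * t ^ ((N : ℝ) - D)) ≤ volume (nbhd N A t ∩ Ω)) :
    ∀ᶠ u in atTop, ENNReal.ofReal (K * u ^ (-((N : ℝ) - D)))
      ≤ volume.restrict (nbhd N A δ ∩ Ω) {x | u < (infDist x A)⁻¹} := by
  filter_upwards [tendsto_inv_atTop_nhdsGT_zero.eventually h, eventually_gt_atTop δ⁻¹]
    with u hu huδ
  have hu0 : 0 < u := (inv_pos.2 hδ).trans huδ
  rw [Real.inv_rpow hu0.le, ← Real.rpow_neg hu0.le] at hu
  refine hu.trans ?_
  rw [Measure.restrict_apply' ((measurableSet_nbhd δ).inter hΩ),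
    ← measure_sdiff_null hnull]
  refine measure_mono fun x hx => ?_
  have hx1 : infDist x A < u⁻¹ := hx.1.1
  have hpos : 0 < infDist x A :=
    infDist_nonneg.lt_of_ne fun h0 => hx.2 ⟨h0.symm, hx.1.2⟩
  exact ⟨(lt_inv_comm₀ hpos hu0).1 hx1, hx1.trans (inv_lt_of_inv_lt₀ hδ huδ), hx.1.2⟩

theorem volume_infDist_eq_zero_inter (hDN : D < N)
    (h : ∀ᶠ t in 𝓝[>] (0 : ℝ),
      volume (nbhd N A t ∩ Ω) ≤ ENNReal.ofReal (K * t ^ ((N : ℝ) - D))) :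
    volume ({x | infDist x A = 0} ∩ Ω) = 0 := by
  have ha : 0 < (N : ℝ) - D := sub_pos.2 hDN
  have hlim : Tendsto (fun t : ℝ => ENNReal.ofReal (K * t ^ ((N : ℝ) - D))) (𝓝[>] 0) (𝓝 0) := by
    have : Tendsto (fun t : ℝ => K * t ^ ((N : ℝ) - D)) (𝓝 0) (𝓝 (K * 0 ^ ((N : ℝ) - D))) :=
      ((Real.continuousAt_rpow_const 0 _ (Or.inr ha.le)).tendsto).const_mul K
    rw [Real.zero_rpow ha.ne', mul_zero] at this
    simpa using ENNReal.tendsto_ofReal (this.mono_left nhdsWithin_le_nhds)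
  refine le_antisymm (ge_of_tendsto hlim ?_) zero_le
  filter_upwards [h, self_mem_nhdsWithin] with t ht ht0
  refine (measure_mono (inter_subset_inter_left _ fun x hx => ?_)).trans ht
  exact (show infDist x A = 0 from hx).trans_lt ht0

theorem eventually_volume_le_of_upperContent_lt (hK : upperContent N A Ω D < ENNReal.ofReal K) :
    ∀ᶠ t in 𝓝[>] (0 : ℝ),
      volume (nbhd N A t ∩ Ω) ≤ ENNReal.ofReal (K * t ^ ((N : ℝ) - D)) := by
  have hK0 : 0 ≤ K := (ENNReal.ofReal_pos.1 (pos_of_gt hK)).le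
  filter_upwards [eventually_lt_of_limsup_lt hK, self_mem_nhdsWithin] with t ht ht0
  rw [ENNReal.ofReal_mul hK0]
  have hpos : 0 < t ^ ((N : ℝ) - D) := Real.rpow_pos_of_pos ht0 _
  exact (ENNReal.div_le_iff (ENNReal.ofReal_pos.2 hpos).ne' ENNReal.ofReal_ne_top).1 ht.le

theorem eventually_le_volume_of_lt_lowerContent (hK0 : 0 ≤ K)
    (hK : ENNReal.ofReal K < lowerContent N A Ω D) :
    ∀ᶠ t in 𝓝[>] (0 : ℝ),
      ENNReal.ofReal (K * t ^ ((N : ℝ) - D)) ≤ volume (nbhd N A t ∩ Ω) := by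
  filter_upwards [eventually_lt_of_lt_liminf hK] with t ht
  rw [ENNReal.ofReal_mul hK0]
  exact ENNReal.mul_le_of_le_div ht.le

theorem lowerContent_le_upperContent : lowerContent N A Ω D ≤ upperContent N A Ω D :=
  liminf_le_limsup

theorem MinkMeasurable.eventually_volume_le {M : ℝ} (h : MinkMeasurable N A Ω D M)
    (hΩ : volume Ω < ⊤) (hK : M < K) :
    ∀ᶠ t in 𝓝[>] (0 : ℝ),
      volume (nbhd N A t ∩ Ω) ≤ ENNReal.ofReal (K * t ^ ((N : ℝ) - D)) := by
  filter_upwards [h.2.eventually_lt_const hK, self_mem_nhdsWithin] with t ht ht0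
  have hpos : 0 < t ^ ((N : ℝ) - D) := Real.rpow_pos_of_pos ht0 _
  exact (ENNReal.le_ofReal_iff_toReal_le (measure_inter_lt_top_of_right_ne_top hΩ.ne).ne
    (mul_pos (h.1.trans hK) hpos).le).2 ((div_le_iff₀ hpos).1 ht.le)

theorem MinkMeasurable.eventually_le_volume {M : ℝ} (h : MinkMeasurable N A Ω D M)
    (hΩ : volume Ω < ⊤) (hK : K < M) :
    ∀ᶠ t in 𝓝[>] (0 : ℝ),
      ENNReal.ofReal (K * t ^ ((N : ℝ) - D)) ≤ volume (nbhd N A t ∩ Ω) := by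
  filter_upwards [h.2.eventually_const_lt hK, self_mem_nhdsWithin] with t ht ht0
  have hpos : 0 < t ^ ((N : ℝ) - D) := Real.rpow_pos_of_pos ht0 _
  exact (ENNReal.ofReal_le_iff_le_toReal (measure_inter_lt_top_of_right_ne_top hΩ.ne).ne).2
    ((le_div_iff₀ hpos).1 ht.le)

/-- The real residue quotient `(s - D) ζ(s; δ)` for real `s`. -/
def residueQuot (N : ℕ) (A Ω : Set (EuclideanSpace ℝ (Fin N))) (D δ s : ℝ) : ℝ :=
  (s - D) * (∫⁻ x in nbhd N A δ ∩ Ω,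
    ENNReal.ofReal ((infDist x A)⁻¹ ^ ((N : ℝ) - s))).toReal

theorem tendsto_const_sub_nhdsLT (c D : ℝ) : Tendsto (c - ·) (𝓝[>] D) (𝓝[<] (c - D)) := by
  refine tendsto_nhdsWithin_iff.2 ⟨?_, ?_⟩
  · exact ((continuous_const.sub continuous_id).tendsto D).mono_left nhdsWithin_le_nhds
  · filter_upwards [self_mem_nhdsWithin] with s hs
    exact sub_lt_sub_left hs c

theorem measurable_inv_infDist : Measurable fun x => (infDist x A)⁻¹ :=
  measurable_infDist.inv

theorem eventually_residueQuot_le (hΩ : MeasurableSet Ω) (hΩ' : volume Ω < ⊤) (hDN : D < N)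
    (hK : 0 ≤ K)
    (h : ∀ᶠ t in 𝓝[>] (0 : ℝ),
      volume (nbhd N A t ∩ Ω) ≤ ENNReal.ofReal (K * t ^ ((N : ℝ) - D))) {ε : ℝ} (hε : 0 < ε) :
    ∀ᶠ s in 𝓝[>] D, residueQuot N A Ω D δ s ≤ ((N : ℝ) - D) * K + ε := by
  have : IsFiniteMeasure (volume.restrict (nbhd N A δ ∩ Ω)) :=
    isFiniteMeasure_restrict.2 (measure_inter_lt_top_of_right_ne_top hΩ'.ne).ne
  have key := eventually_moment_le measurable_inv_infDist
    (fun x => inv_nonneg.2 infDist_nonneg) (sub_pos.2 hDN) hK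
    (eventually_meas_lt_inv_infDist_le (δ := δ) hΩ h) hε
  filter_upwards [(tendsto_const_sub_nhdsLT N D).eventually key] with s hs
  simpa [residueQuot] using hs.2

theorem eventually_le_residueQuot (hΩ : MeasurableSet Ω) (hΩ' : volume Ω < ⊤) (hDN : D < N)
    (hδ : 0 < δ) (hK : 0 ≤ K) {K' : ℝ} (hK' : 0 ≤ K')
    (h : ∀ᶠ t in 𝓝[>] (0 : ℝ),
      ENNReal.ofReal (K * t ^ ((N : ℝ) - D)) ≤ volume (nbhd N A t ∩ Ω))
    (h' : ∀ᶠ t in 𝓝[>] (0 : ℝ),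
      volume (nbhd N A t ∩ Ω) ≤ ENNReal.ofReal (K' * t ^ ((N : ℝ) - D))) {ε : ℝ} (hε : 0 < ε) :
    ∀ᶠ s in 𝓝[>] D, ((N : ℝ) - D) * K - ε ≤ residueQuot N A Ω D δ s := by
  have : IsFiniteMeasure (volume.restrict (nbhd N A δ ∩ Ω)) :=
    isFiniteMeasure_restrict.2 (measure_inter_lt_top_of_right_ne_top hΩ'.ne).ne
  have hg0 (x : EuclideanSpace ℝ (Fin N)) : 0 ≤ (infDist x A)⁻¹ := inv_nonneg.2 infDist_nonneg
  have hfin := (eventually_moment_le measurable_inv_infDist hg0 (sub_pos.2 hDN) hK'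
    (eventually_meas_lt_inv_infDist_le (δ := δ) hΩ h') one_pos).mono fun p hp => hp.1
  have key := eventually_le_moment measurable_inv_infDist hg0 (sub_pos.2 hDN) hK
    (eventually_le_meas_lt_inv_infDist hΩ hδ (volume_infDist_eq_zero_inter hDN h') h) hfin hε
  filter_upwards [(tendsto_const_sub_nhdsLT N D).eventually key] with s hs
  simpa [residueQuot] using hs

end Drum

theorem tendsto_ofReal_nhdsGT_nhdsNE (D : ℝ) :
    Tendsto (fun s : ℝ => (s : ℂ)) (𝓝[>] D) (𝓝[≠] (D : ℂ)) := by
  refine tendsto_nhdsWithin_iff.2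
    ⟨(continuous_ofReal.tendsto D).mono_left nhdsWithin_le_nhds, ?_⟩
  filter_upwards [self_mem_nhdsWithin] with s hs
  simpa using hs.ne'

/-- A meromorphic function which is real and bounded along a real ray ending at `D` has a real
limit at `D`. -/
theorem MeromorphicAt.exists_tendsto_ofReal {G : ℂ → ℂ} {D B : ℝ} {φ : ℝ → ℝ}
    (hG : MeromorphicAt G D) (hφ : ∀ᶠ s : ℝ in 𝓝[>] D, G s = φ s) (hB : ∀ᶠ s in 𝓝[>] D, |φ s| ≤ B) :
    ∃ r : ℝ, Tendsto G (𝓝[≠] (D : ℂ)) (𝓝 (r : ℂ)) ∧ Tendsto φ (𝓝[>] D) (𝓝 r) := by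
  have hray := tendsto_ofReal_nhdsGT_nhdsNE D
  rcases lt_or_ge (meromorphicOrderAt G D) 0 with ho | ho
  · have h1 := (tendsto_norm_atTop_iff_cobounded.2
      (tendsto_cobounded_of_meromorphicOrderAt_neg ho)).comp hray
    obtain ⟨s, hs1, hs2, hs3⟩ := ((h1.eventually_gt_atTop B).and (hφ.and hB)).exists
    simp only [Function.comp_apply, hs2, norm_real, Real.norm_eq_abs] at hs1
    exact absurd hs3 hs1.not_ge
  · obtain ⟨c, hc⟩ := tendsto_nhds_of_meromorphicOrderAt_nonneg hG ho
    have h1 : Tendsto (fun s => (φ s : ℂ)) (𝓝[>] D) (𝓝 c) := (hc.comp hray).congr' hφ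
    have hre : Tendsto φ (𝓝[>] D) (𝓝 c.re) := by
      simpa [Function.comp_def] using (continuous_re.tendsto c).comp h1
    have hc' : c = (c.re : ℂ) :=
      tendsto_nhds_unique h1 ((continuous_ofReal.tendsto c.re).comp hre)
    exact ⟨c.re, hc' ▸ hc, hre⟩

/-- Let `(A,Ω)` be a Minkowski nondegenerate RFD in `ℝ^N` with `D := dim_B(A,Ω)` and `D < N`.
Fix `δ > 0`, let `U` be an open connected neighborhood of `D` and `F` meromorphic on `U`
agreeing with `ζ_{A,Ω}(·;δ)` on `{Re s > D}`.  Then `D` is a simple pole of `F`: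
the limit `r := lim_{s→D}(s−D)F(s)` exists, is real and nonzero; moreover
`(N−D)·M_*^D(A,Ω) ≤ r ≤ (N−D)·M^{*D}(A,Ω)`, and if `(A,Ω)` is Minkowski measurable
then `r = (N−D)·M^D(A,Ω)`. -/
theorem statement3
    (N : ℕ) (A Ω : Set (EuclideanSpace ℝ (Fin N))) (D δ : ℝ) (U : Set ℂ) (F : ℂ → ℂ)
    (hRFD : IsRFD N A Ω) (hD : IsMinkDim N A Ω D)
    (hnd₁ : 0 < lowerContent N A Ω D) (hnd₂ : upperContent N A Ω D < ⊤)
    (hDN : D < N) (hδ : 0 < δ)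
    (hU : IsOpen U) (hUconn : IsPreconnected U) (hDU : (D : ℂ) ∈ U)
    (hF : MeromorphicOn F U)
    (hFzeta : ∀ s ∈ U, D < s.re → F s = distZetaD N A Ω δ s) :
    ∃ r : ℝ, r ≠ 0 ∧
      Tendsto (fun s : ℂ => (s - (D : ℂ)) * F s)
        (nhdsWithin (D : ℂ) {(D : ℂ)}ᶜ) (nhds (r : ℂ)) ∧
      ((N : ℝ) - D) * (lowerContent N A Ω D).toReal ≤ r ∧
      r ≤ ((N : ℝ) - D) * (upperContent N A Ω D).toReal ∧
      ∀ M : ℝ, MinkMeasurable N A Ω D M → r = ((N : ℝ) - D) * M := by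
  obtain ⟨-, hΩ, hΩ', -⟩ := hRFD
  have ha : 0 < (N : ℝ) - D := sub_pos.2 hDN
  obtain ⟨K₀, hK₀⟩ : ∃ K₀ : ℝ, upperContent N A Ω D < ENNReal.ofReal K₀ := by
    obtain ⟨q, hq, -⟩ := ENNReal.lt_iff_exists_nnreal_btwn.1 hnd₂
    exact ⟨q, by simpa using hq⟩
  have hK₀0 : 0 ≤ K₀ := (ENNReal.ofReal_pos.1 (pos_of_gt hK₀)).le
  have hV₀ := eventually_volume_le_of_upperContent_lt hK₀
  have hφ : ∀ᶠ s : ℝ in 𝓝[>] D, ((s : ℂ) - D) * F s = residueQuot N A Ω D δ s := by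
    filter_upwards [(tendsto_ofReal_nhdsGT_nhdsNE D).eventually
      (nhdsWithin_le_nhds (hU.mem_nhds hDU)), self_mem_nhdsWithin] with s hsU hs
    rw [hFzeta s hsU (by simpa using hs), distZetaD_ofReal, residueQuot]
    push_cast
    rfl
  have hB : ∀ᶠ s in 𝓝[>] D, |residueQuot N A Ω D δ s| ≤ ((N : ℝ) - D) * K₀ + 1 := by
    filter_upwards [eventually_residueQuot_le (δ := δ) hΩ hΩ' hDN hK₀0 hV₀ one_pos,
      self_mem_nhdsWithin] with s hs hsD
    rwa [residueQuot, abs_of_nonneg (mul_nonneg (sub_nonneg.2 (le_of_lt hsD)) ENNReal.toReal_nonneg)]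
  obtain ⟨r, hr, hφr⟩ := MeromorphicAt.exists_tendsto_ofReal
    (((MeromorphicAt.id _).sub (MeromorphicAt.const _ _)).mul (hF D hDU)) hφ hB
  have upper {K : ℝ} (hK : 0 ≤ K) (h : ∀ᶠ t in 𝓝[>] (0 : ℝ),
      volume (nbhd N A t ∩ Ω) ≤ ENNReal.ofReal (K * t ^ ((N : ℝ) - D))) :
      r / ((N : ℝ) - D) ≤ K :=
    (div_le_iff₀' ha).2 <| le_of_forall_pos_le_add fun ε hε =>
      le_of_tendsto hφr (eventually_residueQuot_le hΩ hΩ' hDN hK h hε)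
  have lower {K : ℝ} (hK : 0 ≤ K) (h : ∀ᶠ t in 𝓝[>] (0 : ℝ),
      ENNReal.ofReal (K * t ^ ((N : ℝ) - D)) ≤ volume (nbhd N A t ∩ Ω)) :
      K ≤ r / ((N : ℝ) - D) :=
    (le_div_iff₀' ha).2 <| le_of_forall_pos_le_add fun ε hε => sub_le_iff_le_add.1 <|
      ge_of_tendsto hφr (eventually_le_residueQuot hΩ hΩ' hDN hδ hK hK₀0 h hV₀ hε)
  have hlow_top : lowerContent N A Ω D ≠ ⊤ := (lowerContent_le_upperContent.trans_lt hnd₂).ne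
  have hlow : ((N : ℝ) - D) * (lowerContent N A Ω D).toReal ≤ r := by
    refine (le_div_iff₀' ha).1 (le_of_forall_lt_imp_le_of_dense fun k hk => ?_)
    rcases le_total 0 k with hk0 | hk0
    · exact lower hk0 (eventually_le_volume_of_lt_lowerContent hk0
        ((ENNReal.ofReal_lt_iff_lt_toReal hk0 hlow_top).2 hk))
    · exact hk0.trans (lower le_rfl (by simp))
  refine ⟨r, ?_, hr, hlow, ?_, fun M hM => ?_⟩
  · exact ((mul_pos ha (ENNReal.toReal_pos hnd₁.ne' hlow_top)).trans_le hlow).ne'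
  · refine (div_le_iff₀' ha).1 (le_of_forall_gt_imp_ge_of_dense fun k hk => ?_)
    exact upper (ENNReal.toReal_nonneg.trans hk.le) (eventually_volume_le_of_upperContent_lt
      ((ENNReal.lt_ofReal_iff_toReal_lt hnd₂.ne).2 hk))
  · refine (div_eq_iff ha.ne').1 (le_antisymm ?_ ?_) |>.trans (mul_comm _ _)
    · exact le_of_forall_gt_imp_ge_of_dense fun k hk =>
        upper (hM.1.trans hk).le (hM.eventually_volume_le hΩ' hk)
    · refine le_of_forall_lt_imp_le_of_dense fun k hk => ?_
      rcases le_total 0 k with hk0 | hk0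
      · exact lower hk0 (hM.eventually_le_volume hΩ' hk)
      · exact hk0.trans (lower le_rfl (by simp))

end
end

section
/- Let (A,Ω) be a relative fractal drum in ℝ^N and let λ > 0. Then dim̄_B(λA, λΩ) = dim̄_B(A,Ω) =: D̄, and for every s ∈ ℂ with Re s > D̄ one has ∫_{λΩ} dist(x, λA)^{s−N} dx = λ^s · ∫_Ω dist(x,A)^{s−N} dx, i.e., ζ_{λA,λΩ}(s) = λ^s · ζ_{A,Ω}(s). -/
open MeasureTheory Filter Complex Set Metric Topology Asymptotics
open scoped ENNReal NNReal

noncomputable section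

open scoped Pointwise in
theorem nbhd_smul_inter_smul (N : ℕ) (A Ω : Set (EuclideanSpace ℝ (Fin N))) {lam : ℝ}
    (hlam : 0 < lam) (t : ℝ) :
    nbhd N (lam • A) (lam * t) ∩ lam • Ω = lam • (nbhd N A t ∩ Ω) := by
  rw [Set.smul_set_inter₀ hlam.ne']
  congr 1
  ext x
  obtain ⟨y, rfl⟩ : ∃ y, x = lam • y := ⟨lam⁻¹ • x, by rw [smul_inv_smul₀ hlam.ne']⟩
  rw [Set.smul_mem_smul_set_iff₀ hlam.ne']
  simp only [nbhd, Set.mem_ofPred_eq]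
  rw [infDist_smul₀ hlam.ne', Real.norm_of_nonneg hlam.le, mul_lt_mul_iff_right₀ hlam]

open scoped Pointwise in
theorem upperContent_smul (N : ℕ) (A Ω : Set (EuclideanSpace ℝ (Fin N))) {lam : ℝ}
    (hlam : 0 < lam) (r : ℝ) :
    upperContent N (lam • A) (lam • Ω) r
      = ENNReal.ofReal (lam ^ r) * upperContent N A Ω r := by
  have hmap : map (lam * ·) (𝓝[>] (0 : ℝ)) = 𝓝[>] 0 := by
    conv_lhs => rw [← comap_mulLeft_nhdsGT_zero hlam]
    exact map_comap_of_surjective (mul_left_surjective₀ hlam.ne') _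
  unfold upperContent
  conv_lhs => rw [← hmap]
  rw [← limsup_comp, ← ENNReal.limsup_const_mul_of_ne_top ENNReal.ofReal_ne_top]
  refine limsup_congr (eventually_mem_nhdsWithin.mono fun t ht => ?_)
  have ht : 0 < t := ht
  have hpow : lam ^ N = lam ^ r * lam ^ ((N : ℝ) - r) := by
    rw [← Real.rpow_add hlam, add_sub_cancel, Real.rpow_natCast]
  have hpos : 0 < lam ^ ((N : ℝ) - r) := Real.rpow_pos_of_pos hlam _
  simp only [Function.comp_apply]
  rw [nbhd_smul_inter_smul N A Ω hlam, Measure.addHaar_smul_of_nonneg _ hlam.le,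
    finrank_euclideanSpace_fin, Real.mul_rpow hlam.le ht.le, hpow,
    ENNReal.ofReal_mul (Real.rpow_nonneg hlam.le _), ENNReal.ofReal_mul hpos.le,
    mul_comm (ENNReal.ofReal (lam ^ r)), mul_assoc,
    ENNReal.mul_div_mul_left _ _ (ENNReal.ofReal_pos.2 hpos).ne' ENNReal.ofReal_ne_top,
    mul_div_assoc]

open scoped Pointwise in
theorem isUpperMinkDim_smul_iff (N : ℕ) (A Ω : Set (EuclideanSpace ℝ (Fin N))) {lam : ℝ}
    (hlam : 0 < lam) (D : ℝ) :
    IsUpperMinkDim N (lam • A) (lam • Ω) D ↔ IsUpperMinkDim N A Ω D := by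
  have hne (r : ℝ) : ENNReal.ofReal (lam ^ r) ≠ 0 :=
    (ENNReal.ofReal_pos.2 (Real.rpow_pos_of_pos hlam r)).ne'
  simp only [IsUpperMinkDim, upperContent_smul N A Ω hlam, mul_eq_zero, hne, false_or]

open scoped Pointwise in
theorem distZeta_smul (N : ℕ) (A Ω : Set (EuclideanSpace ℝ (Fin N))) {lam : ℝ}
    (hlam : 0 < lam) (s : ℂ) :
    distZeta N (lam • A) (lam • Ω) s = (lam : ℂ) ^ s * distZeta N A Ω s := by
  have hlam' : (lam : ℂ) ≠ 0 := ofReal_ne_zero.2 hlam.ne'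
  have hchange := Measure.setIntegral_comp_smul_of_pos volume
    (fun x => (infDist x (lam • A) : ℂ) ^ (s - (N : ℂ))) Ω hlam
  simp only [infDist_smul₀ hlam.ne', Real.norm_of_nonneg hlam.le, ofReal_mul,
    mul_cpow_ofReal_nonneg hlam.le infDist_nonneg, integral_const_mul,
    finrank_euclideanSpace_fin] at hchange
  rw [eq_inv_smul_iff₀ (pow_ne_zero _ hlam.ne'), cpow_sub _ _ hlam', cpow_natCast,
    real_smul, ofReal_pow, ← mul_assoc, mul_div_cancel₀ _ (pow_ne_zero N hlam')] at hchange
  exact hchange.symm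

/-- Let `(A,Ω)` be a relative fractal drum in `ℝ^N` and `λ > 0`.  Then
`dim̄_B(λA, λΩ) = dim̄_B(A,Ω) =: D̄`, and for every `s` with `Re s > D̄`,
`ζ_{λA,λΩ}(s) = λ^s · ζ_{A,Ω}(s)`. -/
theorem statement6
    (N : ℕ) (A Ω : Set (EuclideanSpace ℝ (Fin N))) (lam Dbar : ℝ)
    (hRFD : IsRFD N A Ω) (hlam : 0 < lam)
    (hD : IsUpperMinkDim N A Ω Dbar) :
    IsUpperMinkDim N ((fun x => lam • x) '' A) ((fun x => lam • x) '' Ω) Dbar ∧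
    ∀ s : ℂ, Dbar < s.re →
      distZeta N ((fun x => lam • x) '' A) ((fun x => lam • x) '' Ω) s
        = (lam : ℂ) ^ s * distZeta N A Ω s := by
  exact ⟨(isUpperMinkDim_smul_iff N A Ω hlam Dbar).2 hD,
    fun s _ => distZeta_smul N A Ω hlam s⟩

end
end

section
/- Let C ⊂ [0,1] be the classical ternary Cantor set, i.e., the attractor of the iterated function system {x ↦ x/3, x ↦ (x+2)/3} on ℝ. Then for every s ∈ ℂ with Re s > log 2/log 3, ∫_{(0,1)} dist(x,C)^{s−1} dx = 2^{1−s} / (s·(3^s − 2)), where 2^{1−s} := exp((1−s) log 2) and 3^s := exp(s log 3). -/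
open MeasureTheory Filter Complex Set Metric Topology
open scoped ENNReal

noncomputable section

/-- Splitting `[0, 1]` into thirds and rescaling the two outer ones. -/
lemma integral_eq_outer_thirds_add_middle {E : Type*} [NormedAddCommGroup E] [NormedSpace ℝ E]
    {G : ℝ → E} (hG : IntervalIntegrable G volume 0 1) :
    ∫ x in (0 : ℝ)..1, G x = (3 : ℝ)⁻¹ • (∫ x in (0 : ℝ)..1, G (x / 3))
      + (∫ x in (1 / 3 : ℝ)..(2 / 3), G x)
      + (3 : ℝ)⁻¹ • (∫ x in (0 : ℝ)..1, G ((x + 2) / 3)) := by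
  have hsub : ∀ a b : ℝ, a ∈ Icc (0 : ℝ) 1 → b ∈ Icc (0 : ℝ) 1 →
      IntervalIntegrable G volume a b := fun a b ha hb => hG.mono_set <| by
    rw [uIcc_of_le zero_le_one]
    exact uIcc_subset_Icc ha hb
  have h1 := hsub 0 (1 / 3) (by norm_num) (by norm_num)
  have h2 := hsub (1 / 3) (2 / 3) (by norm_num) (by norm_num)
  have h3 := hsub (2 / 3) 1 (by norm_num) (by norm_num)
  rw [← intervalIntegral.integral_add_adjacent_intervals (h1.trans h2) h3,
    ← intervalIntegral.integral_add_adjacent_intervals h1 h2]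
  have e1 : (3 : ℝ)⁻¹ • (∫ x in (0 : ℝ)..1, G (x / 3)) = ∫ x in (0 : ℝ)..(1 / 3), G x := by
    rw [intervalIntegral.inv_smul_integral_comp_div]
    norm_num
  have e3 : (3 : ℝ)⁻¹ • (∫ x in (0 : ℝ)..1, G ((x + 2) / 3)) =
      ∫ x in (2 / 3 : ℝ)..1, G x := by
    simp only [add_div]
    rw [intervalIntegral.inv_smul_integral_comp_div_add]
    norm_num
  rw [e1, e3]

/-- A function on `[0, 1]` that scales by the factor `c` under the two maps of the Cantor system is
integrable as soon as it is integrable on the middle third and `2‖c‖ < 3`. -/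
lemma intervalIntegrable_of_self_similar {F : ℝ → ℂ} {c : ℂ} (hF : Measurable F)
    (hleft : ∀ x ∈ Icc (0 : ℝ) 1, F (x / 3) = c * F x)
    (hright : ∀ x ∈ Icc (0 : ℝ) 1, F ((x + 2) / 3) = c * F x)
    (hc : 2 * ‖c‖ < 3) (hmid : IntervalIntegrable F volume (1 / 3) (2 / 3)) :
    IntervalIntegrable F volume 0 1 := by
  set k : ℝ := max ‖c‖ 1 with hk
  have hk1 : 1 ≤ k := le_max_right _ _
  have hk3 : 2 * k < 3 := by
    rcases max_choice ‖c‖ 1 with h | h <;> rw [hk, h] <;> linarith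
  set K : ℝ := ∫ x in (1 / 3 : ℝ)..(2 / 3), ‖F x‖
  have hmeas : ∀ M : ℝ, Measurable fun x => min ‖F x‖ M := fun M => hF.norm.min measurable_const
  have hminInt : ∀ M : ℝ, 0 ≤ M → ∀ g : ℝ → ℝ, Measurable g → ∀ a b : ℝ,
      IntervalIntegrable (fun x => min ‖F (g x)‖ M) volume a b := fun M hM g hg a b => by
    refine (intervalIntegrable_const (c := M)).mono_fun
      ((hmeas M).comp hg).aestronglyMeasurable (Eventually.of_forall fun x => ?_)
    beta_reduce
    rw [Real.norm_of_nonneg (le_min (norm_nonneg _) hM), Real.norm_of_nonneg hM]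
    exact min_le_right _ _
  have hscale : ∀ M : ℝ, 0 ≤ M → ∀ z : ℂ, min ‖c * z‖ M ≤ k * min ‖z‖ M := fun M hM z => by
    rw [mul_min_of_nonneg _ _ (by linarith : 0 ≤ k), norm_mul]
    refine min_le_min (by gcongr; exact le_max_left _ _) ?_
    nlinarith
  have hbound : ∀ M : ℝ, 0 ≤ M → ∫ x in (0 : ℝ)..1, min ‖F x‖ M ≤ K / (1 - 2 * k / 3) := by
    intro M hM
    have hsplit := integral_eq_outer_thirds_add_middle (hminInt M hM id measurable_id 0 1)
    have hcomp : ∀ g : ℝ → ℝ, Measurable g → (∀ x ∈ Icc (0 : ℝ) 1, F (g x) = c * F x) →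
        ∫ x in (0 : ℝ)..1, min ‖F (g x)‖ M ≤ k * ∫ x in (0 : ℝ)..1, min ‖F x‖ M := by
      intro g hg hgF
      rw [← intervalIntegral.integral_const_mul]
      refine intervalIntegral.integral_mono_on zero_le_one (hminInt M hM g hg 0 1)
        ((hminInt M hM id measurable_id 0 1).const_mul k) fun x hx => ?_
      rw [hgF x hx]
      exact hscale M hM _
    have h1 := hcomp (fun x => x / 3) (by fun_prop) hleft
    have h3 := hcomp (fun x => (x + 2) / 3) (by fun_prop) hright
    have h2 : ∫ x in (1 / 3 : ℝ)..(2 / 3), min ‖F x‖ M ≤ K :=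
      intervalIntegral.integral_mono_on (by norm_num) (hminInt M hM id measurable_id _ _) hmid.norm
        fun x _ => min_le_left _ _
    simp only [id, smul_eq_mul] at hsplit
    rw [le_div_iff₀ (by linarith)]
    linarith
  rw [intervalIntegrable_iff_integrableOn_Ioc_of_le zero_le_one]
  have hcover : AECover (volume.restrict (Ioc (0 : ℝ) 1)) atTop
      fun n : ℕ => {x | ‖F x‖ ≤ n} :=
    { ae_eventually_mem := Eventually.of_forall fun x => by
        filter_upwards [eventually_ge_atTop ⌈‖F x‖⌉₊] with n hn
        exact Nat.ceil_le.mp hn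
      measurableSet := fun n => measurableSet_le hF.norm measurable_const }
  refine hcover.integrable_of_integral_norm_bounded (K / (1 - 2 * k / 3)) (fun n => ?_)
    (Eventually.of_forall fun n => ?_)
  · refine Measure.integrableOn_of_bounded (M := n) (measure_ne_top _ _)
      hF.aestronglyMeasurable ?_
    exact (ae_restrict_iff' (hcover.measurableSet n)).mpr (Eventually.of_forall fun x hx => hx)
  · refine le_trans ?_ (hbound n n.cast_nonneg)
    have hI := (intervalIntegrable_iff_integrableOn_Ioc_of_le zero_le_one).mp
      (hminInt n n.cast_nonneg id measurable_id 0 1)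
    rw [intervalIntegral.integral_of_le zero_le_one]
    calc ∫ x in {x | ‖F x‖ ≤ n}, ‖F x‖ ∂(volume.restrict (Ioc (0 : ℝ) 1))
        = ∫ x in {x | ‖F x‖ ≤ n}, min ‖F x‖ n ∂(volume.restrict (Ioc (0 : ℝ) 1)) :=
          setIntegral_congr_fun (hcover.measurableSet n) fun x hx => (min_eq_left hx).symm
      _ ≤ ∫ x in Ioc (0 : ℝ) 1, min ‖F x‖ n :=
          setIntegral_le_integral hI
            (Eventually.of_forall fun x => le_min (norm_nonneg _) n.cast_nonneg)

section CantorAttractor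

variable {C : Set ℝ}

lemma zero_mem_of_cantor_attractor (hC1 : C ⊆ Icc (0 : ℝ) 1) (hCcompact : IsCompact C)
    (hCne : C.Nonempty)
    (hC : C = (fun x : ℝ => x / 3) '' C ∪ (fun x : ℝ => (x + 2) / 3) '' C) : (0 : ℝ) ∈ C := by
  obtain ⟨m, hm, hle⟩ := hCcompact.exists_isLeast hCne
  have h3 : m / 3 ∈ C := by rw [hC]; exact Or.inl ⟨m, hm, rfl⟩
  have h1 := hle h3
  have h0 := (hC1 hm).1
  rwa [show m = 0 by linarith] at hm

lemma one_mem_of_cantor_attractor (hC1 : C ⊆ Icc (0 : ℝ) 1) (hCcompact : IsCompact C)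
    (hCne : C.Nonempty)
    (hC : C = (fun x : ℝ => x / 3) '' C ∪ (fun x : ℝ => (x + 2) / 3) '' C) : (1 : ℝ) ∈ C := by
  obtain ⟨m, hm, hle⟩ := hCcompact.exists_isGreatest hCne
  have h3 : (m + 2) / 3 ∈ C := by rw [hC]; exact Or.inr ⟨m, hm, rfl⟩
  have h1 := hle h3
  have h0 := (hC1 hm).2
  rwa [show m = 1 by linarith] at hm

lemma infDist_div_three (hC1 : C ⊆ Icc (0 : ℝ) 1) (hCcompact : IsCompact C) (hCne : C.Nonempty)
    (hC : C = (fun x : ℝ => x / 3) '' C ∪ (fun x : ℝ => (x + 2) / 3) '' C)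
    {x : ℝ} (hx : x ∈ Icc (0 : ℝ) 1) : infDist (x / 3) C = 3⁻¹ * infDist x C := by
  apply le_antisymm
  · obtain ⟨y, hy, hxy⟩ := hCcompact.exists_infDist_eq_dist hCne x
    have h3 : y / 3 ∈ C := by rw [hC]; exact Or.inl ⟨y, hy, rfl⟩
    refine (infDist_le_dist_of_mem h3).trans_eq ?_
    rw [hxy, Real.dist_eq, Real.dist_eq, ← sub_div, abs_div, abs_of_pos (zero_lt_three' ℝ)]
    ring
  · obtain ⟨z, hz, hxz⟩ := hCcompact.exists_infDist_eq_dist hCne (x / 3)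
    rw [hxz, Real.dist_eq]
    rw [hC] at hz
    rcases hz with ⟨y, hy, rfl⟩ | ⟨y, hy, rfl⟩
    · have := infDist_le_dist_of_mem (x := x) hy
      rw [Real.dist_eq] at this
      simp only
      rw [← sub_div, abs_div, abs_of_pos (zero_lt_three' ℝ)]
      linarith
    · have := infDist_le_dist_of_mem (x := x)
        (one_mem_of_cantor_attractor hC1 hCcompact hCne hC)
      rw [Real.dist_eq, abs_of_nonpos (by linarith [hx.2])] at this
      have := (hC1 hy).1
      have := neg_le_abs (x / 3 - (y + 2) / 3)
      simp only
      linarith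

lemma infDist_add_two_div_three (hC1 : C ⊆ Icc (0 : ℝ) 1) (hCcompact : IsCompact C)
    (hCne : C.Nonempty)
    (hC : C = (fun x : ℝ => x / 3) '' C ∪ (fun x : ℝ => (x + 2) / 3) '' C)
    {x : ℝ} (hx : x ∈ Icc (0 : ℝ) 1) : infDist ((x + 2) / 3) C = 3⁻¹ * infDist x C := by
  apply le_antisymm
  · obtain ⟨y, hy, hxy⟩ := hCcompact.exists_infDist_eq_dist hCne x
    have h3 : (y + 2) / 3 ∈ C := by rw [hC]; exact Or.inr ⟨y, hy, rfl⟩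
    refine (infDist_le_dist_of_mem h3).trans_eq ?_
    rw [hxy, Real.dist_eq, Real.dist_eq, ← sub_div, abs_div, abs_of_pos (zero_lt_three' ℝ),
      add_sub_add_right_eq_sub]
    ring
  · obtain ⟨z, hz, hxz⟩ := hCcompact.exists_infDist_eq_dist hCne ((x + 2) / 3)
    rw [hxz, Real.dist_eq]
    rw [hC] at hz
    rcases hz with ⟨y, hy, rfl⟩ | ⟨y, hy, rfl⟩
    · have := infDist_le_dist_of_mem (x := x)
        (zero_mem_of_cantor_attractor hC1 hCcompact hCne hC)
      rw [Real.dist_eq, abs_of_nonneg (by linarith [hx.1])] at this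
      have := (hC1 hy).2
      have := le_abs_self ((x + 2) / 3 - y / 3)
      simp only
      linarith
    · have := infDist_le_dist_of_mem (x := x) hy
      rw [Real.dist_eq] at this
      simp only
      rw [← sub_div, abs_div, abs_of_pos (zero_lt_three' ℝ), add_sub_add_right_eq_sub]
      linarith

lemma infDist_of_mem_middle_third (hC1 : C ⊆ Icc (0 : ℝ) 1) (hCcompact : IsCompact C)
    (hCne : C.Nonempty)
    (hC : C = (fun x : ℝ => x / 3) '' C ∪ (fun x : ℝ => (x + 2) / 3) '' C)
    {x : ℝ} (hx : x ∈ Icc (1 / 3 : ℝ) (2 / 3)) :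
    infDist x C = min (x - 1 / 3) (2 / 3 - x) := by
  have h1 : (1 / 3 : ℝ) ∈ C := by
    rw [hC]
    exact Or.inl ⟨1, one_mem_of_cantor_attractor hC1 hCcompact hCne hC, rfl⟩
  have h2 : (2 / 3 : ℝ) ∈ C := by
    rw [hC]
    exact Or.inr ⟨0, zero_mem_of_cantor_attractor hC1 hCcompact hCne hC, by norm_num⟩
  apply le_antisymm
  · refine le_min ((infDist_le_dist_of_mem h1).trans_eq ?_)
      ((infDist_le_dist_of_mem h2).trans_eq ?_)
    · rw [Real.dist_eq, abs_of_nonneg (by linarith [hx.1])]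
    · rw [Real.dist_eq, abs_of_nonpos (by linarith [hx.2]), neg_sub]
  · obtain ⟨z, hz, hxz⟩ := hCcompact.exists_infDist_eq_dist hCne x
    rw [hxz, Real.dist_eq]
    rw [hC] at hz
    rcases hz with ⟨y, hy, rfl⟩ | ⟨y, hy, rfl⟩
    · have := (hC1 hy).2
      exact (min_le_left _ _).trans (le_trans (by linarith) (le_abs_self _))
    · have := (hC1 hy).1
      exact (min_le_right _ _).trans (le_trans (by linarith) (neg_le_abs _))

end CantorAttractor

lemma intervalIntegrable_and_integral_min_cpow {s : ℂ} (hs : 0 < s.re) :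
    IntervalIntegrable (fun x : ℝ => ((min (x - 1 / 3) (2 / 3 - x) : ℝ) : ℂ) ^ (s - 1))
      volume (1 / 3) (2 / 3) ∧
    ∫ x in (1 / 3 : ℝ)..(2 / 3), ((min (x - 1 / 3) (2 / 3 - x) : ℝ) : ℂ) ^ (s - 1)
      = 2 * (((1 / 6 : ℝ) : ℂ) ^ s / s) := by
  have hre : -1 < (s - 1).re := by simpa using hs
  have hs0 : s ≠ 0 := fun h => by simp [h] at hs
  have hpow : IntervalIntegrable (fun t : ℝ => (t : ℂ) ^ (s - 1)) volume 0 (1 / 6) :=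
    intervalIntegral.intervalIntegrable_cpow' hre
  have hval : ∫ t in (0 : ℝ)..(1 / 6), (t : ℂ) ^ (s - 1) = ((1 / 6 : ℝ) : ℂ) ^ s / s := by
    rw [integral_cpow (Or.inl hre)]
    simp [hs0]
  have heq1 : EqOn (fun x : ℝ => ((x - 1 / 3 : ℝ) : ℂ) ^ (s - 1))
      (fun x : ℝ => ((min (x - 1 / 3) (2 / 3 - x) : ℝ) : ℂ) ^ (s - 1))
      (uIcc (1 / 3 : ℝ) (1 / 2)) := fun x hx => by
    rw [uIcc_of_le (by norm_num)] at hx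
    simp only
    rw [min_eq_left (by linarith [hx.2])]
  have heq2 : EqOn (fun x : ℝ => ((2 / 3 - x : ℝ) : ℂ) ^ (s - 1))
      (fun x : ℝ => ((min (x - 1 / 3) (2 / 3 - x) : ℝ) : ℂ) ^ (s - 1))
      (uIcc (1 / 2 : ℝ) (2 / 3)) := fun x hx => by
    rw [uIcc_of_le (by norm_num)] at hx
    simp only
    rw [min_eq_right (by linarith [hx.1])]
  have hint1 : IntervalIntegrable (fun x : ℝ => ((x - 1 / 3 : ℝ) : ℂ) ^ (s - 1)) volume
      (1 / 3) (1 / 2) := by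
    convert hpow.comp_sub_right (1 / 3) using 1 <;> norm_num
  have hint2 : IntervalIntegrable (fun x : ℝ => ((2 / 3 - x : ℝ) : ℂ) ^ (s - 1)) volume
      (1 / 2) (2 / 3) := by
    refine IntervalIntegrable.symm ?_
    convert hpow.comp_sub_left (2 / 3) using 1 <;> norm_num
  have hval1 : ∫ x in (1 / 3 : ℝ)..(1 / 2), ((x - 1 / 3 : ℝ) : ℂ) ^ (s - 1)
      = ((1 / 6 : ℝ) : ℂ) ^ s / s := by
    rw [intervalIntegral.integral_comp_sub_right (fun t : ℝ => (t : ℂ) ^ (s - 1)) (1 / 3), ← hval]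
    norm_num
  have hval2 : ∫ x in (1 / 2 : ℝ)..(2 / 3), ((2 / 3 - x : ℝ) : ℂ) ^ (s - 1)
      = ((1 / 6 : ℝ) : ℂ) ^ s / s := by
    rw [intervalIntegral.integral_comp_sub_left (fun t : ℝ => (t : ℂ) ^ (s - 1)) (2 / 3), ← hval]
    norm_num
  have hint1' := hint1.congr (heq1.mono uIoc_subset_uIcc)
  have hint2' := hint2.congr (heq2.mono uIoc_subset_uIcc)
  refine ⟨hint1'.trans hint2', ?_⟩
  rw [← intervalIntegral.integral_add_adjacent_intervals hint1' hint2',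
    ← intervalIntegral.integral_congr heq1, ← intervalIntegral.integral_congr heq2, hval1, hval2]
  ring

/-- Let `C ⊂ [0,1]` be the classical ternary Cantor set, i.e., the attractor of the IFS
`{x ↦ x/3, x ↦ (x+2)/3}` on `ℝ`.  Then for every `s ∈ ℂ` with `Re s > log 2/log 3`,
`∫_{(0,1)} dist(x,C)^{s−1} dx = 2^{1−s}/(s·(3^s − 2))`. -/
theorem statement8
    (C : Set ℝ)
    (hC1 : C ⊆ Set.Icc (0 : ℝ) 1)
    (hCcompact : IsCompact C) (hCne : C.Nonempty)
    (hCattractor : C = (fun x : ℝ => x / 3) '' C ∪ (fun x : ℝ => (x + 2) / 3) '' C) :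
    ∀ s : ℂ, Real.log 2 / Real.log 3 < s.re →
      ∫ x in Set.Ioo (0 : ℝ) 1, (Metric.infDist x C : ℂ) ^ (s - 1)
        = (2 : ℂ) ^ (1 - s) / (s * ((3 : ℂ) ^ s - 2)) := by
  intro s hs
  have hlog3 : 0 < Real.log 3 := Real.log_pos (by norm_num)
  have hs0 : 0 < s.re := (div_pos (Real.log_pos (by norm_num)) hlog3).trans hs
  have h3s : 2 < (3 : ℝ) ^ s.re := by
    rw [← Real.log_lt_log_iff (by norm_num) (by positivity), Real.log_rpow (by norm_num)]
    exact (div_lt_iff₀ hlog3).mp hs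
  have hsne : s ≠ 0 := fun h => by simp [h] at hs0
  have hnorm3 : ‖(3 : ℂ) ^ s‖ = (3 : ℝ) ^ s.re := by
    simpa using norm_cpow_eq_rpow_re_of_pos (zero_lt_three' ℝ) s
  have h3ne : (3 : ℂ) ^ s ≠ 0 := by simp [cpow_eq_zero_iff]
  have h2ne : (2 : ℂ) ^ s ≠ 0 := by simp [cpow_eq_zero_iff]
  have hden : (3 : ℂ) ^ s - 2 ≠ 0 := fun h => by
    rw [sub_eq_zero.mp h] at hnorm3
    norm_num at hnorm3
    linarith
  have hinv : ∀ a : ℝ, 0 < a → ((a⁻¹ : ℝ) : ℂ) ^ s = ((a : ℂ) ^ s)⁻¹ := fun a ha => by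
    rw [ofReal_inv, inv_cpow _ _ (by rw [arg_ofReal_of_nonneg ha.le]; exact Real.pi_pos.ne)]
  set c : ℂ := ((3⁻¹ : ℝ) : ℂ) ^ (s - 1) with hcdef
  have hc : c = 3 / (3 : ℂ) ^ s := by
    rw [hcdef, cpow_sub _ _ (by norm_num), hinv 3 (by norm_num), cpow_one]
    push_cast
    field_simp
  set F : ℝ → ℂ := fun x => (infDist x C : ℂ) ^ (s - 1) with hFdef
  have hF : Measurable F :=
    (measurable_ofReal.comp (continuous_infDist_pt C).measurable).pow_const _
  have hleft : ∀ x ∈ Icc (0 : ℝ) 1, F (x / 3) = c * F x := fun x hx => by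
    simp only [hFdef, hcdef]
    rw [infDist_div_three hC1 hCcompact hCne hCattractor hx, ofReal_mul,
      mul_cpow_ofReal_nonneg (by norm_num) infDist_nonneg]
  have hright : ∀ x ∈ Icc (0 : ℝ) 1, F ((x + 2) / 3) = c * F x := fun x hx => by
    simp only [hFdef, hcdef]
    rw [infDist_add_two_div_three hC1 hCcompact hCne hCattractor hx, ofReal_mul,
      mul_cpow_ofReal_nonneg (by norm_num) infDist_nonneg]
  have hmid : EqOn (fun x : ℝ => ((min (x - 1 / 3) (2 / 3 - x) : ℝ) : ℂ) ^ (s - 1)) F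
      (uIcc (1 / 3 : ℝ) (2 / 3)) := fun x hx => by
    rw [uIcc_of_le (by norm_num)] at hx
    simp only [hFdef]
    rw [infDist_of_mem_middle_third hC1 hCcompact hCne hCattractor hx]
  obtain ⟨hmidint, hmidval⟩ := intervalIntegrable_and_integral_min_cpow hs0
  have hFint : IntervalIntegrable F volume 0 1 := by
    refine intervalIntegrable_of_self_similar hF hleft hright ?_ (hmidint.congr (hmid.mono uIoc_subset_uIcc))
    rw [hc, norm_div, hnorm3, ← mul_div_assoc, div_lt_iff₀ (by positivity)]
    norm_num
    linarith
  have hcomp : ∀ g : ℝ → ℝ, (∀ x ∈ Icc (0 : ℝ) 1, F (g x) = c * F x) →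
      ∫ x in (0 : ℝ)..1, F (g x) = c * ∫ x in (0 : ℝ)..1, F x := fun g hg => by
    rw [← intervalIntegral.integral_const_mul]
    refine intervalIntegral.integral_congr fun x hx => ?_
    rw [uIcc_of_le zero_le_one] at hx
    exact hg x hx
  have hsplit := integral_eq_outer_thirds_add_middle hFint
  rw [hcomp _ hleft, hcomp _ hright, ← intervalIntegral.integral_congr hmid, hmidval] at hsplit
  have h6 : ((1 / 6 : ℝ) : ℂ) ^ s = ((2 : ℂ) ^ s)⁻¹ * ((3 : ℂ) ^ s)⁻¹ := by
    rw [show (1 / 6 : ℝ) = 2⁻¹ * 3⁻¹ by norm_num, ofReal_mul,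
      mul_cpow_ofReal_nonneg (by norm_num) (by norm_num), hinv 2 (by norm_num),
      hinv 3 (by norm_num)]
    norm_num
  rw [← integral_Ioc_eq_integral_Ioo, ← intervalIntegral.integral_of_le zero_le_one]
  change ∫ x in (0 : ℝ)..1, F x = _
  generalize (∫ x in (0 : ℝ)..1, F x) = I at hsplit ⊢
  rw [h6, hc] at hsplit
  simp only [real_smul] at hsplit
  push_cast at hsplit
  rw [cpow_sub _ _ two_ne_zero, cpow_one]
  field_simp at hsplit ⊢
  linear_combination hsplit

end
end
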